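/- Let S be a set of primes of positive density, (cₙ) real numbers with (1/n)∑_{i≤n} c_i/p_i → 0, and define K(t) = (1/|S(t)|) ∑_{pₙ ∈ S(t)} cₙ/pₙ for t ≥ p₁. If ∫_{p₁}^{∞} |K(t)|/(t·log t) dt < ∞, then the series ∑_{n>0} cₙ/pₙ² converges. -/

import Mathlib

open Filter

/-- For a strictly increasing sequence `p`, the indices `i` with `p i ≤ t` are exactly those up
to `n` whenever `p n ≤ t < p (n + 1)`. -/
theorem setOf_cast_le_eq_range {p : ℕ → ℕ} (hmono : StrictMono p) {n : ℕ} {t : ℝ}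
    (ht : t ∈ Set.Ico (p n : ℝ) (p (n + 1))) :
    {i : ℕ | (p i : ℝ) ≤ t} = (Finset.range (n + 1) : Set ℕ) := by
  ext i
  simp only [Set.mem_ofPred_eq, Finset.coe_range, Set.mem_Iio]
  constructor
  · intro hi
    have h : p i < p (n + 1) := by exact_mod_cast hi.trans_lt ht.2
    exact hmono.lt_iff_lt.mp h
  · intro hi
    have h : (p i : ℝ) ≤ p n := by exact_mod_cast hmono.monotone (Nat.lt_succ_iff.mp hi)
    exact h.trans ht.1

theorem lintegral_Ico_const_div_sq {a b M : ℝ} (ha : 0 < a) (hab : a ≤ b) (hM : 0 ≤ M) :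
    ∫⁻ t in Set.Ico a b, ENNReal.ofReal (M / t ^ 2) = ENNReal.ofReal (M * (a⁻¹ - b⁻¹)) := by
  have hne : ∀ t ∈ Set.uIcc a b, t ≠ 0 := fun t ht => by
    rw [Set.uIcc_of_le hab] at ht
    exact (ha.trans_le ht.1).ne'
  have hcont : ContinuousOn (fun t : ℝ => M / t ^ 2) (Set.uIcc a b) :=
    continuousOn_const.div (by fun_prop) fun t ht => pow_ne_zero 2 (hne t ht)
  have hinteg : IntervalIntegrable (fun t : ℝ => M / t ^ 2) MeasureTheory.volume a b :=
    hcont.intervalIntegrable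
  have hftc : ∫ t in a..b, M / t ^ 2 = M * (a⁻¹ - b⁻¹) := by
    rw [intervalIntegral.integral_eq_sub_of_hasDerivAt (f := fun t => -(M * t⁻¹)) ?_ hinteg]
    · ring
    · intro t ht
      have h : HasDerivAt (fun t => -(M * t⁻¹)) (-(M * -(t ^ 2)⁻¹)) t :=
        ((hasDerivAt_inv (hne t ht)).const_mul M).neg
      rwa [mul_neg, neg_neg, ← div_eq_mul_inv] at h
  rw [← hftc, intervalIntegral.integral_of_le hab, MeasureTheory.restrict_Ico_eq_restrict_Ioc,
    MeasureTheory.ofReal_integral_eq_lintegral_ofReal hinteg.1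
      (Eventually.of_forall fun t => by positivity)]

/-- If the primes `p n` have positive density, the expectations `(1/n) ∑ c i / p i` tend
to `0`, and the error function `K` satisfies `∫ |K(t)| / (t log t) dt < ∞`, then the
series `∑ c n / p n ^ 2` converges. -/
theorem series_converges_of_integrable_error
    (p : ℕ → ℕ) (hp : ∀ n, (p n).Prime) (hmono : StrictMono p)
    (d : ℝ) (hd : 0 < d)
    (hdens : Tendsto
      (fun t : ℝ => (Nat.card {n : ℕ | (p n : ℝ) ≤ t} : ℝ) * Real.log t / t)
      atTop (nhds d))
    (c : ℕ → ℝ)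
    (hexp : Tendsto (fun n : ℕ => (∑ i ∈ Finset.range n, c i / (p i : ℝ)) / n)
      atTop (nhds 0))
    (K : ℝ → ℝ)
    (hK : ∀ t : ℝ, (p 0 : ℝ) ≤ t →
      K t = (∑' n : {n : ℕ | (p n : ℝ) ≤ t}, c n / (p n : ℝ)) /
        (Nat.card {n : ℕ | (p n : ℝ) ≤ t} : ℝ))
    (hint : ∫⁻ t in Set.Ici (p 0 : ℝ), ENNReal.ofReal (|K t| / (t * Real.log t)) < ⊤) :
    ∃ l : ℝ, Tendsto (fun N => ∑ n ∈ Finset.range N, c n / (p n : ℝ) ^ 2)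
      atTop (nhds l) := by
  have hpos : ∀ n, (0 : ℝ) < p n := fun n => by exact_mod_cast (hp n).pos
  have hlt : ∀ n, (p n : ℝ) < p (n + 1) := fun n => by exact_mod_cast hmono n.lt_succ_self
  set A : ℕ → ℝ := fun n => ∑ i ∈ Finset.range n, c i / (p i : ℝ) with hA
  set f : ℝ → ENNReal := fun t => ENNReal.ofReal (|K t| / (t * Real.log t))
  have hbdry : Tendsto (fun N => A N * (p N : ℝ)⁻¹) atTop (nhds 0) := by
    refine squeeze_zero_norm (fun N => ?_) (tendsto_zero_iff_norm_tendsto_zero.mp hexp)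
    rw [div_eq_mul_inv, norm_mul, norm_mul]
    rcases Nat.eq_zero_or_pos N with rfl | hN
    · simp [hA]
    · refine mul_le_mul_of_nonneg_left ?_ (norm_nonneg _)
      rw [norm_inv, norm_inv, RCLike.norm_natCast, RCLike.norm_natCast]
      exact inv_anti₀ (by exact_mod_cast hN) (by exact_mod_cast hmono.le_apply)
  have hJ : ∑' n, ∫⁻ t in Set.Ico (p n : ℝ) (p (n + 1)), f t ≠ ⊤ := by
    have hp_mono : Monotone fun n => (p n : ℝ) := Nat.mono_cast.comp hmono.monotone
    have hdisj : Pairwise (Function.onFun Disjoint fun n => Set.Ico (p n : ℝ) (p (n + 1))) :=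
      hp_mono.pairwise_disjoint_on_Ico_succ
    rw [← MeasureTheory.lintegral_iUnion (fun _ => measurableSet_Ico) hdisj]
    refine ((MeasureTheory.lintegral_mono_set ?_).trans_lt hint).ne
    exact Set.iUnion_subset fun n t ht => (hp_mono n.zero_le).trans ht.1
  have hsum : Summable fun n => A (n + 1) * ((p n : ℝ)⁻¹ - (p (n + 1) : ℝ)⁻¹) := by
    refine Summable.of_norm_bounded_eventually_nat
      ((ENNReal.summable_toReal hJ).mul_left (d + 1)) ?_
    have hp_top : Tendsto (fun n => (p n : ℝ)) atTop atTop :=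
      tendsto_natCast_atTop_atTop.comp hmono.tendsto_atTop
    obtain ⟨T, hT⟩ := eventually_atTop.mp (hdens.eventually (eventually_le_nhds (lt_add_one d)))
    filter_upwards [hp_top.eventually_ge_atTop T] with n hn
    have hb : 0 < (p n : ℝ)⁻¹ - (p (n + 1) : ℝ)⁻¹ := sub_pos.mpr (inv_strictAnti₀ (hpos n) (hlt n))
    rw [norm_mul, Real.norm_eq_abs, Real.norm_eq_abs, abs_of_pos hb, ← div_le_iff₀' (by positivity)]
    refine (ENNReal.ofReal_le_iff_le_toReal (ENNReal.ne_top_of_tsum_ne_top hJ n)).mp ?_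
    rw [mul_div_right_comm, ← lintegral_Ico_const_div_sq (hpos n) (hlt n).le (by positivity)]
    refine MeasureTheory.setLIntegral_mono' measurableSet_Ico fun t ht => ENNReal.ofReal_le_ofReal ?_
    have hset := setOf_cast_le_eq_range hmono ht
    have hKt := hK t ((Nat.cast_le.mpr (hmono.monotone n.zero_le)).trans ht.1)
    have hTt := hT t (hn.trans ht.1)
    rw [hset] at hKt hTt
    rw [Finset.tsum_subtype' (Finset.range (n + 1)) fun i => c i / (p i : ℝ)] at hKt
    have hcard : Nat.card (Finset.range (n + 1) : Set ℕ) = n + 1 := by simp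
    rw [hcard] at hKt hTt
    have ht1 : 1 < t := lt_of_lt_of_le (by exact_mod_cast (hp n).one_lt) ht.1
    have hlog := Real.log_pos ht1
    have ht0 : 0 < t := by linarith
    have hn0 : (0 : ℝ) < (n + 1 : ℕ) := by positivity
    rw [hKt, abs_div, abs_of_pos hn0, div_div, div_div]
    refine div_le_div_of_nonneg_left (abs_nonneg _) (by positivity) ?_
    rw [div_le_iff₀ ht0] at hTt
    nlinarith
  refine ⟨_, (hsum.hasSum.tendsto_sum_nat.add hbdry).congr fun N => ?_⟩
  induction N with
  | zero => simp [hA]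
  | succ N ih =>
    rw [Finset.sum_range_succ, Finset.sum_range_succ, ← ih]
    have hstep : A (N + 1) = A N + c N / p N := Finset.sum_range_succ _ _
    rw [hstep]
    ring
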